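/- arXiv:2302.00974 — 7 statements merged into one kernel-verified Lean document; each statement's English description precedes it below -/
import Mathlib

section
/- Let Õ and Ã_0,…,Ã_{n−1} be d×d real symmetric orthogonal matrices, and let D = diag(λ_0,…,λ_{d−1}) with λ_j > 0 for all j. Then there exists a real symmetric positive definite matrix P such that Õ·P ∈ span_ℝ({D²} ∪ {D Ã_x D : x}) if and only if Õ ∈ sgn(span_ℝ({D²} ∪ {D Ã_x D : x})), i.e., there exists H ∈ span_ℝ({D²} ∪ {D Ã_x D : x}) with Õ = sgn(H). -/
open scoped BigOperators Matrix

noncomputable section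

namespace SelfTest

/-- The sign map on real symmetric matrices via the spectral decomposition:
`sgn(∑ λⱼ uⱼuⱼᵀ) = ∑ sgn(λⱼ) uⱼuⱼᵀ` (and junk value `0` off the symmetric matrices). -/
def msgn {d : ℕ} (H : Matrix (Fin d) (Fin d) ℝ) : Matrix (Fin d) (Fin d) ℝ :=
  if h : H.IsHermitian then
    (h.eigenvectorUnitary : Matrix (Fin d) (Fin d) ℝ) *
      Matrix.diagonal (fun i => Real.sign (h.eigenvalues i)) *
      (star (h.eigenvectorUnitary : Matrix (Fin d) (Fin d) ℝ))
  else 0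

end SelfTest

open SelfTest

open Matrix

variable {d : ℕ}

namespace SelfTest

lemma msgn_mul_self {H : Matrix (Fin d) (Fin d) ℝ} (h : H.IsHermitian) :
    msgn H * H = (h.eigenvectorUnitary : Matrix (Fin d) (Fin d) ℝ) *
      diagonal (fun i => |h.eigenvalues i|) *
      (star (h.eigenvectorUnitary : Matrix (Fin d) (Fin d) ℝ)) := by
  have hU := Unitary.coe_star_mul_self h.eigenvectorUnitary
  have hH := h.spectral_theorem
  rw [Unitary.conjStarAlgAut_apply] at hH
  rw [msgn, dif_pos h]
  set U : Matrix (Fin d) (Fin d) ℝ := (h.eigenvectorUnitary : Matrix (Fin d) (Fin d) ℝ)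
  calc U * diagonal (fun i => Real.sign (h.eigenvalues i)) * star U * H
      = U * diagonal (fun i => Real.sign (h.eigenvalues i)) * star U *
          (U * diagonal h.eigenvalues * star U) := by congr 1
    _ = U * diagonal (fun i => Real.sign (h.eigenvalues i)) * (star U * U) *
          diagonal h.eigenvalues * star U := by simp only [Matrix.mul_assoc]
    _ = _ := by
      rw [hU, Matrix.mul_one, Matrix.mul_assoc U, diagonal_mul_diagonal]
      congr! 4 with i
      rcases lt_trichotomy (h.eigenvalues i) 0 with hi | hi | hi
      · rw [Real.sign_of_neg hi, abs_of_neg hi, neg_one_mul]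
      · simp [hi]
      · rw [Real.sign_of_pos hi, abs_of_pos hi, one_mul]

lemma posSemidef_msgn_mul_self {H : Matrix (Fin d) (Fin d) ℝ} (h : H.IsHermitian) :
    (msgn H * H).PosSemidef := by
  rw [msgn_mul_self h, star_eq_conjTranspose]
  exact (PosSemidef.diagonal fun i => abs_nonneg _).mul_mul_conjTranspose_same _

lemma msgn_mul_self_sq {H : Matrix (Fin d) (Fin d) ℝ} (h : H.IsHermitian) :
    (msgn H * H) * (msgn H * H) = H * H := by
  have hU := Unitary.coe_star_mul_self h.eigenvectorUnitary
  have hH := h.spectral_theorem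
  rw [Unitary.conjStarAlgAut_apply] at hH
  rw [msgn_mul_self h]
  set U : Matrix (Fin d) (Fin d) ℝ := (h.eigenvectorUnitary : Matrix (Fin d) (Fin d) ℝ)
  have key (v w : Fin d → ℝ) : U * diagonal v * star U * (U * diagonal w * star U) =
      U * diagonal (fun i => v i * w i) * star U := by
    calc _ = U * diagonal v * (star U * U) * diagonal w * star U := by
          simp only [Matrix.mul_assoc]
      _ = _ := by rw [hU, Matrix.mul_one, Matrix.mul_assoc U, diagonal_mul_diagonal]
  have hH' : H = U * diagonal h.eigenvalues * star U := hH
  calc _ = U * diagonal (fun i => h.eigenvalues i * h.eigenvalues i) * star U := by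
        rw [key]; simp only [abs_mul_abs_self]
    _ = (U * diagonal h.eigenvalues * star U) * (U * diagonal h.eigenvalues * star U) :=
        (key _ _).symm
    _ = H * H := by rw [← hH']

/-- A positive definite matrix is the only positive semidefinite square root of its square. -/
lemma eq_of_posDef_of_posSemidef_of_mul_self_eq {A B : Matrix (Fin d) (Fin d) ℝ}
    (hA : A.PosDef) (hB : B.PosSemidef) (hAB : A * A = B * B) : A = B := by
  have hX : (A - B)ᴴ = A - B := hA.1.sub hB.1
  have h₁ := hA.posSemidef.conjTranspose_mul_mul_same (A - B)
  have h₂ := hB.mul_mul_conjTranspose_same (A - B)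
  rw [hX] at h₁ h₂
  have hcross : A * (A - B) = -((A - B) * B) := by
    rw [Matrix.mul_sub, Matrix.sub_mul, hAB]
    abel
  have hsum : ((A - B) * A * (A - B)).trace + ((A - B) * B * (A - B)).trace = 0 := by
    rw [Matrix.mul_assoc, hcross, Matrix.mul_neg, trace_neg, trace_mul_comm (A - B),
      neg_add_cancel]
  have h₃ : (A - B) * A * (A - B) = 0 :=
    h₁.trace_eq_zero_iff.1 (by linarith [h₁.trace_nonneg, h₂.trace_nonneg])
  have h₄ : A - B = 0 := by
    by_contra hne
    obtain ⟨v, hv⟩ : ∃ v, (A - B) *ᵥ v ≠ 0 := by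
      by_contra! hall
      exact hne (ext_of_mulVec_single fun j => by rw [hall, zero_mulVec])
    have hpos := hA.dotProduct_mulVec_pos hv
    rw [star_mulVec, hX, ← dotProduct_mulVec, mulVec_mulVec, mulVec_mulVec, h₃, zero_mulVec,
      dotProduct_zero] at hpos
    exact hpos.false
  exact sub_eq_zero.1 h₄

lemma posDef_msgn_mul_self {H : Matrix (Fin d) (Fin d) ℝ} (h : H.IsHermitian)
    (hu : IsUnit (msgn H)) : (msgn H * H).PosDef := by
  rw [msgn_mul_self h, Matrix.IsUnit.posDef_star_right_conjugate_iff Unitary.isUnit_coe,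
    posDef_diagonal_iff]
  rw [msgn, dif_pos h, isUnit_iff_isUnit_det, det_mul, det_mul, det_diagonal,
    isUnit_iff_ne_zero] at hu
  intro i
  rw [abs_pos]
  intro hi
  refine hu ?_
  rw [Finset.prod_eq_zero (Finset.mem_univ i) (by rw [hi, Real.sign_zero]), mul_zero, zero_mul]

lemma isHermitian_of_mem_span {s : Set (Matrix (Fin d) (Fin d) ℝ)}
    (hs : ∀ M ∈ s, M.IsHermitian) {H : Matrix (Fin d) (Fin d) ℝ}
    (hH : H ∈ Submodule.span ℝ s) : H.IsHermitian := by
  induction hH using Submodule.span_induction with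
  | mem M hM => exact hs M hM
  | zero => exact isHermitian_zero
  | add _ _ _ _ h₁ h₂ => exact h₁.add h₂
  | smul c M _ h => rw [IsHermitian, conjTranspose_smul, h.eq, star_trivial]

end SelfTest

/-- closed-form criterion for binary observables. -/
theorem stmt_3 {d n : ℕ}
    (Ot : Matrix (Fin d) (Fin d) ℝ) (hOt : Ot.IsSymm ∧ Ot * Ot = 1)
    (At : Fin n → Matrix (Fin d) (Fin d) ℝ)
    (hAt : ∀ x, (At x).IsSymm ∧ At x * At x = 1)
    (lam : Fin d → ℝ) (hlam : ∀ j, 0 < lam j)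
    (Dm : Matrix (Fin d) (Fin d) ℝ) (hDm : Dm = Matrix.diagonal lam) :
    (∃ P : Matrix (Fin d) (Fin d) ℝ, P.PosDef ∧
        Ot * P ∈ Submodule.span ℝ
          ({Dm * Dm} ∪ Set.range fun x => Dm * At x * Dm)) ↔
      (∃ H ∈ Submodule.span ℝ
          ({Dm * Dm} ∪ Set.range fun x => Dm * At x * Dm), Ot = msgn H) := by
  have hspan {H} (hH : H ∈ Submodule.span ℝ ({Dm * Dm} ∪ Set.range fun x => Dm * At x * Dm)) :
      H.IsHermitian := by
    have hD : Dmᵀ = Dm := by rw [hDm, diagonal_transpose]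
    refine isHermitian_of_mem_span ?_ hH
    rintro _ (rfl | ⟨x, rfl⟩)
    · rw [IsHermitian, conjTranspose_eq_transpose_of_trivial, transpose_mul, hD]
    · rw [IsHermitian, conjTranspose_eq_transpose_of_trivial]
      simp only [transpose_mul, hD, (hAt x).1.eq, Matrix.mul_assoc]
  obtain ⟨hOs, hOO⟩ := hOt
  constructor
  · rintro ⟨P, hP, hmem⟩
    have hH := hspan hmem
    have hPO : P * Ot = Ot * P := by
      have := hH.eq
      rwa [conjTranspose_mul, hP.1.eq, conjTranspose_eq_transpose_of_trivial, hOs.eq] at this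
    refine ⟨Ot * P, hmem, ?_⟩
    have hPP : P * P = msgn (Ot * P) * (Ot * P) * (msgn (Ot * P) * (Ot * P)) := by
      rw [msgn_mul_self_sq hH]
      calc P * P = P * (Ot * Ot) * P := by rw [hOO, Matrix.mul_one]
        _ = (P * Ot) * (Ot * P) := by simp only [Matrix.mul_assoc]
        _ = (Ot * P) * (Ot * P) := by rw [hPO]
    have hPeq := eq_of_posDef_of_posSemidef_of_mul_self_eq hP (posSemidef_msgn_mul_self hH) hPP
    have h₁ : (msgn (Ot * P) * Ot) * P = 1 * P := by
      rw [Matrix.mul_assoc, ← hPeq, Matrix.one_mul]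
    have h₂ : msgn (Ot * P) * Ot = 1 := hP.isUnit.mul_right_cancel h₁
    exact (left_inv_eq_right_inv h₂ hOO).symm
  · rintro ⟨H, hmem, rfl⟩
    have hH := hspan hmem
    refine ⟨msgn H * H, ?_, by rwa [← Matrix.mul_assoc, hOO, Matrix.one_mul]⟩
    exact posDef_msgn_mul_self hH (.of_mul_eq_one _ hOO)
end
end

section
/- Let d ≥ 2 and let v_0,…,v_d ∈ ℝ^d be unit vectors with v_jᵀ v_k = −1/d for all j ≠ k. For j ≠ k, the vector w_{jk} := √(d/(2(d+1))) (v_j − v_k) is a unit vector; the matrix T_j + T_k (where T_x := 2 v_x v_xᵀ − I) has eigenvalue 2/d with eigenvector w_{jk}, eigenvalue −2/d with eigenvector v_j + v_k, and eigenvalue −2 on the orthogonal complement of span{v_j, v_k}; consequently sgn(T_j + T_k) = 2 w_{jk} w_{jk}ᵀ − I. -/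
open scoped BigOperators Matrix

noncomputable section

open SelfTest Matrix

theorem msgn_mulVec_of_eigenvector {d : ℕ} {H : Matrix (Fin d) (Fin d) ℝ} (h : H.IsHermitian)
    {x : Fin d → ℝ} {μ : ℝ} (hx : H *ᵥ x = μ • x) : msgn H *ᵥ x = Real.sign μ • x := by
  set U := (h.eigenvectorUnitary : Matrix (Fin d) (Fin d) ℝ) with hU
  have hUU : star U * U = 1 := Unitary.coe_star_mul_self h.eigenvectorUnitary
  have hUU' : U * star U = 1 := Unitary.coe_mul_star_self h.eigenvectorUnitary
  have hH : H = U * diagonal h.eigenvalues * star U := h.spectral_theorem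
  set y := star U *ᵥ x with hy
  have hxy : U *ᵥ y = x := by rw [hy, mulVec_mulVec, hUU', one_mulVec]
  have hdiag : diagonal h.eigenvalues *ᵥ y = μ • y := by
    have hleft : star U * H = diagonal h.eigenvalues * star U := by
      conv_lhs => rw [hH]
      rw [← mul_assoc, ← mul_assoc, hUU, one_mul]
    rw [hy, mulVec_mulVec, ← hleft, ← mulVec_mulVec, hx, mulVec_smul]
  have hsign : diagonal (fun i => Real.sign (h.eigenvalues i)) *ᵥ y = Real.sign μ • y := by
    ext i
    have hi := congrFun hdiag i
    simp only [mulVec_diagonal, Pi.smul_apply, smul_eq_mul] at hi ⊢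
    rcases eq_or_ne (y i) 0 with h0 | h0
    · simp [h0]
    · rw [mul_right_cancel₀ h0 hi]
  rw [msgn, dif_pos h, ← mulVec_mulVec, ← mulVec_mulVec, ← hU, ← hy, hsign, mulVec_smul, hxy]

theorem reflection_add_mulVec {n : Type*} [Fintype n] [DecidableEq n] (a b x : n → ℝ) :
    (((2 : ℝ) • vecMulVec a a - 1) + ((2 : ℝ) • vecMulVec b b - 1)) *ᵥ x =
      (2 * (a ⬝ᵥ x)) • a + (2 * (b ⬝ᵥ x)) • b - (2 : ℝ) • x := by
  ext i
  simp only [add_mulVec, sub_mulVec, smul_mulVec, vecMulVec_mulVec, one_mulVec, Pi.add_apply,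
    Pi.sub_apply, Pi.smul_apply, smul_eq_mul, MulOpposite.smul_eq_mul_unop, MulOpposite.unop_op]
  ring

theorem isHermitian_reflection {n : Type*} [DecidableEq n] (a : n → ℝ) :
    ((2 : ℝ) • vecMulVec a a - 1).IsHermitian := by
  ext i j
  simp [vecMulVec_apply, one_apply, mul_comm, eq_comm]

/-- spectral analysis of `T_j + T_k` for simplex observables. -/
theorem stmt_6 {d : ℕ} (hd : 2 ≤ d)
    (v : Fin (d + 1) → Fin d → ℝ)
    (hunit : ∀ j, v j ⬝ᵥ v j = 1)
    (hangle : ∀ j k, j ≠ k → v j ⬝ᵥ v k = -(1 / d))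
    (T : Fin (d + 1) → Matrix (Fin d) (Fin d) ℝ)
    (hT : ∀ x, T x = (2 : ℝ) • Matrix.vecMulVec (v x) (v x) - 1)
    (w : Fin (d + 1) → Fin (d + 1) → Fin d → ℝ)
    (hw : ∀ j k, w j k = Real.sqrt (d / (2 * (d + 1))) • (v j - v k))
    (j k : Fin (d + 1)) (hjk : j ≠ k) :
    w j k ⬝ᵥ w j k = 1 ∧
    (T j + T k).mulVec (w j k) = ((2 : ℝ) / d) • w j k ∧
    (T j + T k).mulVec (v j + v k) = (-((2 : ℝ) / d)) • (v j + v k) ∧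
    (∀ u : Fin d → ℝ, u ⬝ᵥ v j = 0 → u ⬝ᵥ v k = 0 →
      (T j + T k).mulVec u = (-2 : ℝ) • u) ∧
    msgn (T j + T k) = (2 : ℝ) • Matrix.vecMulVec (w j k) (w j k) - 1 := by
  have hd2 : (2 : ℝ) ≤ d := by exact_mod_cast hd
  have hd0 : (d : ℝ) ≠ 0 := by positivity
  have hkj : v k ⬝ᵥ v j = -(1 / d) := hangle k j hjk.symm
  have hsqrt : √((d : ℝ) / (2 * (d + 1))) * √((d : ℝ) / (2 * (d + 1))) = d / (2 * (d + 1)) :=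
    Real.mul_self_sqrt (by positivity)
  have hsqrt0 : √((d : ℝ) / (2 * (d + 1))) ≠ 0 := by positivity
  have hww : w j k ⬝ᵥ w j k = 1 := by
    simp only [hw, smul_dotProduct, dotProduct_smul, sub_dotProduct, dotProduct_sub, hunit,
      hangle j k hjk, hkj, smul_eq_mul]
    rw [← mul_sub, ← mul_assoc, hsqrt]
    field_simp
    ring
  have hTw : (T j + T k) *ᵥ w j k = ((2 : ℝ) / d) • w j k := by
    rw [hw, mulVec_smul, smul_comm, hT, hT, reflection_add_mulVec]
    congr 1
    ext i
    simp only [dotProduct_sub, hunit, hangle j k hjk, hkj, Pi.add_apply, Pi.sub_apply,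
      Pi.smul_apply, smul_eq_mul]
    ring
  have hTs : (T j + T k) *ᵥ (v j + v k) = (-((2 : ℝ) / d)) • (v j + v k) := by
    rw [hT, hT, reflection_add_mulVec]
    ext i
    simp only [dotProduct_add, hunit, hangle j k hjk, hkj, Pi.add_apply, Pi.sub_apply,
      Pi.smul_apply, smul_eq_mul]
    ring
  have hTu : ∀ u : Fin d → ℝ, u ⬝ᵥ v j = 0 → u ⬝ᵥ v k = 0 →
      (T j + T k) *ᵥ u = (-2 : ℝ) • u := by
    intro u huj huk
    rw [hT, hT, reflection_add_mulVec, dotProduct_comm (v j), dotProduct_comm (v k), huj, huk]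
    simp
  refine ⟨hww, hTw, hTs, hTu, ?_⟩
  have hherm : (T j + T k).IsHermitian := by
    rw [hT, hT]
    exact (isHermitian_reflection _).add (isHermitian_reflection _)
  have hss : (v j + v k) ⬝ᵥ (v j + v k) = 2 - 2 / d := by
    simp only [add_dotProduct, dotProduct_add, hunit, hangle j k hjk, hkj]
    ring
  have hss0 : (2 : ℝ) - 2 / d ≠ 0 := by
    have : (2 : ℝ) / d ≤ 1 := (div_le_one (by positivity)).2 hd2
    linarith
  have hws : w j k ⬝ᵥ (v j + v k) = 0 := by
    simp only [hw, smul_dotProduct, sub_dotProduct, dotProduct_add, hunit, hangle j k hjk, hkj,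
      smul_eq_mul]
    ring
  have hsw : (v j + v k) ⬝ᵥ w j k = 0 := by rw [dotProduct_comm, hws]
  refine ext_of_mulVec_single fun i => ?_
  generalize (Pi.single i 1 : Fin d → ℝ) = x
  set a := x ⬝ᵥ w j k with ha
  set b := x ⬝ᵥ (v j + v k) / (2 - 2 / d) with hb
  set u := x - a • w j k - b • (v j + v k) with hu
  have hx : x = a • w j k + b • (v j + v k) + u := by
    rw [hu]
    abel
  have huw : u ⬝ᵥ w j k = 0 := by
    rw [hu, sub_dotProduct, sub_dotProduct, smul_dotProduct, smul_dotProduct, hww, hsw, ← ha,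
      smul_eq_mul, smul_eq_mul]
    ring
  have hus : u ⬝ᵥ v j + u ⬝ᵥ v k = 0 := by
    rw [← dotProduct_add, hu, sub_dotProduct, sub_dotProduct, smul_dotProduct, smul_dotProduct,
      hss, hws, hb, smul_eq_mul, smul_eq_mul, div_mul_cancel₀ _ hss0]
    ring
  have hud : u ⬝ᵥ v j - u ⬝ᵥ v k = 0 := by
    rw [hw, dotProduct_smul, dotProduct_sub, smul_eq_mul] at huw
    exact (mul_eq_zero.1 huw).resolve_left hsqrt0
  have hTu' := hTu u (by linarith) (by linarith)
  have hpos : (0 : ℝ) < 2 / d := by positivity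
  have hSw := msgn_mulVec_of_eigenvector hherm hTw
  have hSs := msgn_mulVec_of_eigenvector hherm hTs
  have hSu := msgn_mulVec_of_eigenvector hherm hTu'
  rw [Real.sign_of_pos hpos] at hSw
  rw [Real.sign_of_neg (neg_lt_zero.2 hpos)] at hSs
  rw [Real.sign_of_neg (by norm_num)] at hSu
  have hwx : w j k ⬝ᵥ x = a := dotProduct_comm _ _
  rw [sub_mulVec, smul_mulVec, vecMulVec_mulVec, one_mulVec, hwx, op_smul_eq_smul]
  conv_lhs => rw [hx, mulVec_add, mulVec_add, mulVec_smul, mulVec_smul, hSw, hSs, hSu]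
  conv_rhs => rw [hx]
  module
end
end

section
/- Let d > 2 and let v_0,…,v_d ∈ ℝ^d be unit vectors with v_jᵀ v_k = −1/d for all j ≠ k. Define T_{jk} := 2 w_{jk} w_{jk}ᵀ − I for 0 ≤ j < k ≤ d, where w_{jk} := √(d/(2(d+1))) (v_j − v_k). Then the d(d+1)/2 matrices {T_{jk} : 0 ≤ j < k ≤ d} are linearly independent over ℝ, and hence span the space H_d(ℝ) of all d×d real symmetric matrices. -/
open scoped BigOperators Matrix

noncomputable section

open SelfTest Matrix

/-- The number of ordered pairs `j < k` in `Fin (d + 1)` is `d (d + 1) / 2`. -/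
lemma card_pairs_lt (d : ℕ) :
    Fintype.card {p : Fin (d + 1) × Fin (d + 1) // p.1 < p.2} = d * (d + 1) / 2 := by
  rw [Fintype.card_subtype, Finset.card_filter, Fintype.sum_prod_type_right]
  have h : ∀ k : Fin (d + 1), ∑ j : Fin (d + 1), (if j < k then 1 else 0) = (k : ℕ) := fun k => by
    rw [← Finset.card_filter, Finset.filter_gt_eq_Iio, Fin.card_Iio]
  simp only [h]
  rw [Fin.sum_univ_eq_sum_range (fun i => i), Finset.sum_range_id, Nat.add_sub_cancel, mul_comm]

/-- The submodule of symmetric matrices. -/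
def symmSubmodule (n : Type*) : Submodule ℝ (Matrix n n ℝ) where
  carrier := {A | A.IsSymm}
  add_mem' := IsSymm.add
  zero_mem' := isSymm_zero
  smul_mem' c _ h := h.smul c

/-- A symmetric matrix seen as a function on unordered pairs of indices. -/
def symmToSym2 (n : Type*) : symmSubmodule n →ₗ[ℝ] (Sym2 n → ℝ) where
  toFun A := Sym2.lift ⟨fun i j => A.1 i j, fun i j => A.2.apply j i⟩
  map_add' A B := by
    ext z
    induction z with | _ i j => simp
  map_smul' c A := by
    ext z
    induction z with | _ i j => simp

lemma symmToSym2_injective (n : Type*) : Function.Injective (symmToSym2 n) := by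
  intro A B h
  ext i j
  simpa [symmToSym2] using congrFun h s(i, j)

lemma finrank_symmSubmodule_le (d : ℕ) :
    Module.finrank ℝ (symmSubmodule (Fin d)) ≤ d * (d + 1) / 2 := by
  refine (LinearMap.finrank_le_finrank_of_injective (symmToSym2_injective (Fin d))).trans ?_
  rw [Module.finrank_fintype_fun_eq_card, Sym2.card, Fintype.card_fin, Nat.choose_two_right,
    Nat.add_sub_cancel, mul_comm]

/-- Linearly independent symmetric matrices, `d (d + 1) / 2` in number, span all symmetric
matrices. -/
lemma mem_span_of_isSymm {d : ℕ} {ι : Type*} [Fintype ι] {T : ι → Matrix (Fin d) (Fin d) ℝ}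
    (hT : ∀ i, (T i).IsSymm) (hli : LinearIndependent ℝ T)
    (hcard : Fintype.card ι = d * (d + 1) / 2) {H : Matrix (Fin d) (Fin d) ℝ} (hH : H.IsSymm) :
    H ∈ Submodule.span ℝ (Set.range T) := by
  have hle : Submodule.span ℝ (Set.range T) ≤ symmSubmodule (Fin d) := by
    rw [Submodule.span_le]
    rintro _ ⟨i, rfl⟩
    exact hT i
  rw [Submodule.eq_of_le_of_finrank_le hle]
  · exact hH
  · rw [finrank_span_eq_card hli, hcard]
    exact finrank_symmSubmodule_le d

/-- A product of differences of Kronecker deltas at `a < b` and `j < k` is nonzero only if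
`(j, k) = (a, b)`. -/
lemma ite_sub_ite_mul {α : Type*} [LinearOrder α] {a b j k : α} (hab : a < b) (hjk : j < k) :
    ((if a = j then 1 else 0) - (if a = k then 1 else 0) : ℝ) *
      ((if b = j then 1 else 0) - (if b = k then 1 else 0)) =
      if j = a ∧ k = b then -1 else 0 := by
  grind

lemma linearIndependent_simplex {d : ℕ} (hd : 2 < d)
    (v : Fin (d + 1) → Fin d → ℝ)
    (hunit : ∀ j, v j ⬝ᵥ v j = 1)
    (hangle : ∀ j k, j ≠ k → v j ⬝ᵥ v k = -(1 / d))
    (T : Fin (d + 1) → Fin (d + 1) → Matrix (Fin d) (Fin d) ℝ)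
    (hT : ∀ j k, T j k = ((d : ℝ) / (d + 1)) • vecMulVec (v j - v k) (v j - v k) - 1) :
    LinearIndependent ℝ
      (fun p : {p : Fin (d + 1) × Fin (d + 1) // p.1 < p.2} => T p.1.1 p.1.2) := by
  have hd2 : (2 : ℝ) < d := by exact_mod_cast hd
  have hd0 : (d : ℝ) ≠ 0 := by linarith
  have hd1 : (d : ℝ) + 1 ≠ 0 := by linarith
  have hdot : ∀ a j k, v a ⬝ᵥ (v j - v k) =
      (((d : ℝ) + 1) / d) * ((if a = j then 1 else 0) - (if a = k then 1 else 0)) := by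
    have hgram : ∀ a j, v a ⬝ᵥ v j = (((d : ℝ) + 1) / d) * (if a = j then 1 else 0) - 1 / d := by
      intro a j
      split_ifs with h
      · subst h
        rw [hunit]
        field_simp
        ring
      · rw [hangle a j h]
        ring
    intro a j k
    rw [dotProduct_sub, hgram, hgram]
    ring
  have htrace : ∀ j k, j < k → (T j k).trace = 2 - d := by
    intro j k hjk
    rw [hT, trace_sub, trace_smul, trace_vecMulVec, sub_dotProduct, hdot, hdot, trace_one,
      Fintype.card_fin, if_pos rfl, if_neg hjk.ne, if_neg hjk.ne', if_pos rfl, smul_eq_mul]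
    field_simp
    ring
  have hform : ∀ a b j k, a < b → j < k → v a ⬝ᵥ (T j k *ᵥ v b) =
      (if j = a ∧ k = b then -(((d : ℝ) + 1) / d) else 0) + 1 / d := by
    intro a b j k hab hjk
    have hmul : v a ⬝ᵥ (T j k *ᵥ v b) =
        ((d : ℝ) / (d + 1)) * ((v a ⬝ᵥ (v j - v k)) * (v b ⬝ᵥ (v j - v k))) - v a ⬝ᵥ v b := by
      rw [hT, sub_mulVec, smul_mulVec, vecMulVec_mulVec, one_mulVec, dotProduct_sub,
        dotProduct_smul, op_smul_eq_smul, dotProduct_smul, dotProduct_comm (v b), smul_eq_mul,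
        smul_eq_mul]
      ring
    rw [hmul, hdot, hdot, mul_mul_mul_comm, ite_sub_ite_mul hab hjk, hangle a b hab.ne]
    split_ifs <;> field_simp <;> ring
  rw [Fintype.linearIndependent_iff]
  intro c hc
  have hsum : ∑ p, c p = 0 := by
    have h := congrArg trace hc
    rw [trace_sum, trace_zero, Finset.sum_congr rfl fun p _ => by
      rw [trace_smul, htrace _ _ p.2, smul_eq_mul], ← Finset.sum_mul] at h
    exact (mul_eq_zero.1 h).resolve_right (by linarith)
  rintro ⟨⟨a, b⟩, hab⟩
  have h := congrArg (fun M => v a ⬝ᵥ (M *ᵥ v b)) hc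
  simp only [sum_mulVec, dotProduct_sum, smul_mulVec, dotProduct_smul, zero_mulVec,
    dotProduct_zero] at h
  rw [Finset.sum_congr rfl fun p _ => by rw [hform a b _ _ hab p.2, smul_eq_mul, mul_add],
    Finset.sum_add_distrib, ← Finset.sum_mul, hsum, zero_mul, add_zero,
    Finset.sum_eq_single ⟨(a, b), hab⟩] at h
  · simpa [hd0, hd1] using h
  · rintro ⟨⟨j, k⟩, hjk⟩ _ hne
    rw [if_neg, mul_zero]
    rintro ⟨rfl, rfl⟩
    exact hne rfl
  · simp

/-- the matrices `T_{jk} = 2 w_{jk} w_{jk}ᵀ − I`, `0 ≤ j < k ≤ d`,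
are linearly independent and span the symmetric matrices (Lemma `spanall`). -/
theorem stmt_7 {d : ℕ} (hd : 2 < d)
    (v : Fin (d + 1) → Fin d → ℝ)
    (hunit : ∀ j, v j ⬝ᵥ v j = 1)
    (hangle : ∀ j k, j ≠ k → v j ⬝ᵥ v k = -(1 / d))
    (w : Fin (d + 1) → Fin (d + 1) → Fin d → ℝ)
    (hw : ∀ j k, w j k = Real.sqrt (d / (2 * (d + 1))) • (v j - v k))
    (T2 : Fin (d + 1) → Fin (d + 1) → Matrix (Fin d) (Fin d) ℝ)
    (hT2 : ∀ j k, T2 j k = (2 : ℝ) • Matrix.vecMulVec (w j k) (w j k) - 1) :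
    Fintype.card {p : Fin (d + 1) × Fin (d + 1) // p.1 < p.2} = d * (d + 1) / 2 ∧
    LinearIndependent ℝ
      (fun p : {p : Fin (d + 1) × Fin (d + 1) // p.1 < p.2} => T2 p.1.1 p.1.2) ∧
    ∀ H : Matrix (Fin d) (Fin d) ℝ, H.IsSymm →
      H ∈ Submodule.span ℝ
        (Set.range fun p : {p : Fin (d + 1) × Fin (d + 1) // p.1 < p.2} =>
          T2 p.1.1 p.1.2) := by
  have hT : ∀ j k, T2 j k = ((d : ℝ) / (d + 1)) • vecMulVec (v j - v k) (v j - v k) - 1 := by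
    intro j k
    have hd1 : (d : ℝ) + 1 ≠ 0 := by positivity
    rw [hT2, hw, smul_vecMulVec, vecMulVec_smul, smul_smul, smul_smul, mul_assoc,
      Real.mul_self_sqrt (by positivity)]
    congr 2
    field_simp
  have hli := linearIndependent_simplex hd v hunit hangle T2 hT
  refine ⟨card_pairs_lt d, hli, fun H hH => mem_span_of_isSymm (fun p => ?_) hli
    (card_pairs_lt d) hH⟩
  rw [hT]
  exact (IsSymm.smul (transpose_vecMulVec _ _) _).sub isSymm_one
end
end

section
/- Let d ≥ 2 and let v_0,…,v_d ∈ ℝ^d be unit vectors with v_jᵀ v_k = −1/d for all j ≠ k, and set T_{jk} := 2 w_{jk} w_{jk}ᵀ − I with w_{jk} := √(d/(2(d+1))) (v_j − v_k). Then ∑_{1 ≤ j < k ≤ d} T_{jk} + d · v_0 v_0ᵀ + (d(d−3)/2) · I = 0. -/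
open scoped BigOperators Matrix

noncomputable section

open SelfTest Matrix

/-- The vertices of a regular simplex sum to zero and form a tight frame. -/
theorem simplex_sum_eq_zero_and_frame {d : ℕ} (hd : 0 < d)
    (v : Fin (d + 1) → Fin d → ℝ)
    (hunit : ∀ j, v j ⬝ᵥ v j = 1)
    (hangle : ∀ j k, j ≠ k → v j ⬝ᵥ v k = -(1 / d)) :
    (∀ a, ∑ j, v j a = 0) ∧
      ∀ a b, (d : ℝ) * ∑ j, v j a * v j b =
        ((d : ℝ) + 1) * (1 : Matrix (Fin d) (Fin d) ℝ) a b := by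
  have hd0 : (d : ℝ) ≠ 0 := by positivity
  have hd1 : (d : ℝ) + 1 ≠ 0 := by positivity
  let A : Matrix (Fin (d + 1)) (Fin d ⊕ Unit) ℝ :=
    Matrix.of fun j => Sum.elim (v j) fun _ => 1
  let B : Matrix (Fin d ⊕ Unit) (Fin (d + 1)) ℝ :=
    Matrix.of fun s j => Sum.elim (fun a => d / (d + 1) * v j a) (fun _ => 1 / ((d : ℝ) + 1)) s
  have hAB : A * B = 1 := by
    ext j k
    have h : (A * B) j k = d / (d + 1) * (v j ⬝ᵥ v k) + 1 / ((d : ℝ) + 1) := by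
      simp only [A, B, Matrix.mul_apply, Matrix.of_apply, Fintype.sum_sum_type, Sum.elim_inl,
        Sum.elim_inr, dotProduct, Finset.mul_sum, Finset.univ_unique, Finset.sum_singleton,
        one_mul]
      congr 1
      exact Finset.sum_congr rfl fun _ _ => by ring
    rw [h]
    by_cases hjk : j = k
    · subst hjk
      rw [hunit, Matrix.one_apply_eq]
      field_simp
    · rw [hangle j k hjk, Matrix.one_apply_ne hjk]
      field_simp
      ring
  have hBA : B * A = 1 :=
    (Matrix.mul_eq_one_comm_of_card_eq _ _ _ (by simp)).1 hAB
  constructor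
  · intro a
    have h := congrFun (congrFun hBA (Sum.inr ())) (Sum.inl a)
    simp only [A, B, Matrix.mul_apply, Matrix.of_apply, Sum.elim_inl, Sum.elim_inr,
      ← Finset.mul_sum] at h
    rw [Matrix.one_apply_ne (by simp)] at h
    exact (mul_eq_zero.1 h).resolve_left (by positivity)
  · intro a b
    have h := congrFun (congrFun hBA (Sum.inl a)) (Sum.inl b)
    simp only [A, B, Matrix.mul_apply, Matrix.of_apply, Sum.elim_inl, mul_assoc,
      ← Finset.mul_sum] at h
    have h1 : (1 : Matrix (Fin d ⊕ Unit) (Fin d ⊕ Unit) ℝ) (Sum.inl a) (Sum.inl b) =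
        (1 : Matrix (Fin d) (Fin d) ℝ) a b := by
      simp [Matrix.one_apply]
    rw [h1] at h
    rw [← h]
    field_simp

/-- A symmetric function summed over a square is twice its sum above the diagonal plus its
sum over the diagonal. -/
theorem sum_sum_eq_two_mul_sum_lt_add_diag {d : ℕ} (f : Fin d → Fin d → ℝ)
    (hf : ∀ i j, f i j = f j i) :
    ∑ i, ∑ j, f i j = 2 * (∑ i, ∑ j, if i < j then f i j else 0) + ∑ i, f i i := by
  have h : ∑ i, ∑ j, f i j = (∑ i, ∑ j, if i < j then f i j else 0) +
      (∑ i, ∑ j, if j < i then f j i else 0) + ∑ i, ∑ j, if i = j then f i j else 0 := by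
    simp only [← Finset.sum_add_distrib]
    refine Finset.sum_congr rfl fun i _ => Finset.sum_congr rfl fun j _ => ?_
    rcases lt_trichotomy i j with h | h | h
    · simp [h, h.not_gt, h.ne]
    · simp [h]
    · simp [h, h.not_gt, h.ne', hf i j]
  rw [h, Finset.sum_comm (f := fun i j => if j < i then f j i else 0)]
  simp only [Finset.sum_ite_eq, Finset.mem_univ, if_true]
  ring

/-- The bilinear form of the complete-graph Laplacian. -/
theorem sum_sum_sub_mul_sub {d : ℕ} (x y : Fin d → ℝ) :
    ∑ i, ∑ j, (x i - x j) * (y i - y j) =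
      2 * d * ∑ i, x i * y i - 2 * ((∑ i, x i) * ∑ i, y i) := by
  simp only [sub_mul, mul_sub, Finset.sum_sub_distrib, ← Finset.mul_sum, ← Finset.sum_mul,
    Finset.sum_const, Finset.card_univ, Fintype.card_fin, nsmul_eq_mul, mul_left_comm _ (d : ℝ)]
  ring

/-- the linear relation `∑_{1≤j<k≤d} T_{jk} + d·v₀v₀ᵀ + (d(d−3)/2)·I = 0`. -/
theorem stmt_8 {d : ℕ} (hd : 2 ≤ d)
    (v : Fin (d + 1) → Fin d → ℝ)
    (hunit : ∀ j, v j ⬝ᵥ v j = 1)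
    (hangle : ∀ j k, j ≠ k → v j ⬝ᵥ v k = -(1 / d))
    (w : Fin (d + 1) → Fin (d + 1) → Fin d → ℝ)
    (hw : ∀ j k, w j k = Real.sqrt (d / (2 * (d + 1))) • (v j - v k))
    (T2 : Fin (d + 1) → Fin (d + 1) → Matrix (Fin d) (Fin d) ℝ)
    (hT2 : ∀ j k, T2 j k = (2 : ℝ) • Matrix.vecMulVec (w j k) (w j k) - 1) :
    (∑ p ∈ Finset.univ.filter
        (fun p : Fin (d + 1) × Fin (d + 1) => 0 < p.1 ∧ p.1 < p.2), T2 p.1 p.2) +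
      (d : ℝ) • Matrix.vecMulVec (v 0) (v 0) +
      (((d : ℝ) * ((d : ℝ) - 3)) / 2) • (1 : Matrix (Fin d) (Fin d) ℝ) = 0 := by
  have hd0 : (0 : ℝ) < d := by exact_mod_cast (by omega : 0 < d)
  obtain ⟨hsum, hframe⟩ := simplex_sum_eq_zero_and_frame (by omega) v hunit hangle
  ext a b
  have hT : ∀ j k, T2 j k a b = d / (d + 1) * ((v j a - v k a) * (v j b - v k b)) -
      (1 : Matrix (Fin d) (Fin d) ℝ) a b := by
    intro j k
    have hs : Real.sqrt (d / (2 * (d + 1))) * Real.sqrt (d / (2 * (d + 1))) =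
        (d : ℝ) / (2 * (d + 1)) := Real.mul_self_sqrt (by positivity)
    simp only [hT2, hw, Matrix.sub_apply, Matrix.smul_apply, Matrix.vecMulVec_apply,
      Pi.smul_apply, Pi.sub_apply, smul_eq_mul]
    rw [mul_mul_mul_comm, hs]
    field_simp
  simp only [Matrix.add_apply, Matrix.sum_apply, Matrix.smul_apply, Matrix.vecMulVec_apply,
    smul_eq_mul, Matrix.zero_apply]
  have hS : ∑ p ∈ Finset.univ.filter
      (fun p : Fin (d + 1) × Fin (d + 1) => 0 < p.1 ∧ p.1 < p.2), T2 p.1 p.2 a b =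
      ∑ i : Fin d, ∑ j : Fin d, if i < j then T2 i.succ j.succ a b else 0 := by
    rw [Finset.sum_filter, Fintype.sum_prod_type]
    simp [Fin.sum_univ_succ]
  rw [hS]
  have h1 := sum_sum_eq_two_mul_sum_lt_add_diag (fun i j : Fin d => T2 i.succ j.succ a b)
    fun i j => by simp only [hT]; ring
  have h2 := sum_sum_sub_mul_sub (fun i : Fin d => v i.succ a) fun i => v i.succ b
  have h3 : ∑ i : Fin d, ∑ j : Fin d, T2 i.succ j.succ a b =
      d / (d + 1) * (∑ i : Fin d, ∑ j : Fin d,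
        (v i.succ a - v j.succ a) * (v i.succ b - v j.succ b)) -
      d * (d * (1 : Matrix (Fin d) (Fin d) ℝ) a b) := by
    simp only [hT, Finset.sum_sub_distrib, ← Finset.mul_sum, Finset.sum_const,
      Finset.card_univ, Fintype.card_fin, nsmul_eq_mul]
  have h4 : ∑ i : Fin d, T2 i.succ i.succ a b =
      -(d * (1 : Matrix (Fin d) (Fin d) ℝ) a b) := by
    simp [hT]
  have ha := hsum a
  have hb := hsum b
  have hab := hframe a b
  rw [Fin.sum_univ_succ] at ha hb hab
  rw [h3, h4, h2, eq_neg_of_add_eq_zero_right ha, eq_neg_of_add_eq_zero_right hb] at h1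
  have h5 : (d : ℝ) / (d + 1) * (2 * d * ∑ i : Fin d, v i.succ a * v i.succ b -
      2 * (-v 0 a * -v 0 b)) =
      2 * d * (1 : Matrix (Fin d) (Fin d) ℝ) a b - 2 * d * (v 0 a * v 0 b) := by
    field_simp
    linear_combination hab
  rw [h5] at h1
  linear_combination (-1 / 2 : ℝ) * h1
end
end

section
/- Let d > 2 and let v_0,…,v_d ∈ ℝ^d be unit vectors with v_jᵀ v_k = −1/d for all j ≠ k. Define T_x := 2 v_x v_xᵀ − I for x ∈ {0,…,d} and T_{jk} := 2 w_{jk} w_{jk}ᵀ − I with w_{jk} := √(d/(2(d+1))) (v_j − v_k) for j ≠ k. Then for every j ∈ {1,…,d}, the matrix T_{0j} lies in span_ℝ({T_x : 0 ≤ x ≤ d} ∪ {T_{kl} : 1 ≤ k < l ≤ d}). -/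
open scoped BigOperators Matrix

noncomputable section

open SelfTest Matrix

/-- The vertices of a centered regular simplex sum to zero and form a tight frame. -/
lemma simplex_sum_and_frame {d : ℕ} (hd : 0 < d) (v : Fin (d + 1) → Fin d → ℝ)
    (hunit : ∀ j, v j ⬝ᵥ v j = 1)
    (hangle : ∀ j k, j ≠ k → v j ⬝ᵥ v k = -(1 / d)) :
    ∑ x, v x = 0 ∧
      ∑ x, vecMulVec (v x) (v x) = ((d + 1 : ℝ) / d) • (1 : Matrix (Fin d) (Fin d) ℝ) := by
  have hd0 : (d : ℝ) ≠ 0 := by positivity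
  have hd1 : (d : ℝ) + 1 ≠ 0 := by positivity
  let A : Matrix (Fin (d + 1)) (Fin d ⊕ Unit) ℝ :=
    of fun x => Sum.elim (v x) fun _ => 1
  let B : Matrix (Fin d ⊕ Unit) (Fin (d + 1)) ℝ := of fun i x =>
    Sum.elim (fun i => (d / (d + 1) : ℝ) * v x i) (fun _ => 1 / (d + 1)) i
  have hAB : A * B = 1 := by
    ext x y
    have h : (A * B) x y = d / (d + 1) * (v x ⬝ᵥ v y) + 1 / (d + 1) := by
      simp only [A, B, mul_apply, of_apply, Fintype.sum_sum_type, Sum.elim_inl, Sum.elim_inr, dotProduct,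
        Finset.mul_sum, Finset.univ_unique, Finset.sum_singleton, one_mul]
      congr 1
      exact Finset.sum_congr rfl fun i _ => by ring
    rw [h]
    rcases eq_or_ne x y with rfl | hxy
    · rw [hunit, one_apply_eq]
      field_simp
    · rw [hangle x y hxy, one_apply_ne hxy]
      field_simp
      ring
  have hBA : B * A = 1 :=
    (mul_eq_one_comm_of_equiv (Fintype.equivOfCardEq (by simp))).mp hAB
  constructor
  · ext i
    have h := congrFun (congrFun hBA (Sum.inr ())) (Sum.inl i)
    simp only [A, B, mul_apply, of_apply, Sum.elim_inl, Sum.elim_inr, ← Finset.mul_sum] at h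
    rw [one_apply_ne (by simp)] at h
    simpa [hd1] using h
  · ext i k
    have h := congrFun (congrFun hBA (Sum.inl i)) (Sum.inl k)
    simp only [A, B, mul_apply, of_apply, Sum.elim_inl, mul_assoc, ← Finset.mul_sum] at h
    have h1 : (1 : Matrix (Fin d ⊕ Unit) (Fin d ⊕ Unit) ℝ) (Sum.inl i) (Sum.inl k) =
        (1 : Matrix (Fin d) (Fin d) ℝ) i k := by
      simp [one_apply]
    rw [h1] at h
    simp only [Matrix.sum_apply, vecMulVec_apply, Matrix.smul_apply, smul_eq_mul, ← h]
    field_simp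

/-- each `T_{0j}` lies in the span of
`{T_x : 0 ≤ x ≤ d} ∪ {T_{kl} : 1 ≤ k < l ≤ d}`. -/
theorem stmt_9 {d : ℕ} (hd : 2 < d)
    (v : Fin (d + 1) → Fin d → ℝ)
    (hunit : ∀ j, v j ⬝ᵥ v j = 1)
    (hangle : ∀ j k, j ≠ k → v j ⬝ᵥ v k = -(1 / d))
    (T : Fin (d + 1) → Matrix (Fin d) (Fin d) ℝ)
    (hT : ∀ x, T x = (2 : ℝ) • Matrix.vecMulVec (v x) (v x) - 1)
    (w : Fin (d + 1) → Fin (d + 1) → Fin d → ℝ)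
    (hw : ∀ j k, w j k = Real.sqrt (d / (2 * (d + 1))) • (v j - v k))
    (T2 : Fin (d + 1) → Fin (d + 1) → Matrix (Fin d) (Fin d) ℝ)
    (hT2 : ∀ j k, T2 j k = (2 : ℝ) • Matrix.vecMulVec (w j k) (w j k) - 1) :
    ∀ j : Fin (d + 1), j ≠ 0 →
      T2 0 j ∈ Submodule.span ℝ
        (Set.range T ∪
          {M | ∃ k l : Fin (d + 1), 0 < k ∧ k < l ∧ M = T2 k l}) := by
  have hd0 : (d : ℝ) ≠ 0 := by positivity
  have hd1 : (d : ℝ) + 1 ≠ 0 := by positivity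
  have hd2 : (2 : ℝ) - d ≠ 0 := by
    have : (2 : ℝ) < d := by exact_mod_cast hd
    linarith
  obtain ⟨hsum, hframe⟩ := simplex_sum_and_frame (by omega) v hunit hangle
  set S := Submodule.span ℝ
    (Set.range T ∪ {M | ∃ k l : Fin (d + 1), 0 < k ∧ k < l ∧ M = T2 k l})
  have hTS : ∀ x, T x ∈ S := fun x => Submodule.subset_span (Or.inl ⟨x, rfl⟩)
  have hone : (1 : Matrix (Fin d) (Fin d) ℝ) ∈ S := by
    have h : (1 : Matrix (Fin d) (Fin d) ℝ) = (d / ((d + 1) * (2 - d)) : ℝ) • ∑ x, T x := by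
      simp only [hT, Finset.sum_sub_distrib, ← Finset.smul_sum, hframe, Finset.sum_const,
        Finset.card_univ, Fintype.card_fin]
      rw [← Nat.cast_smul_eq_nsmul ℝ, smul_smul, ← sub_smul, smul_smul]
      conv_lhs => rw [← one_smul ℝ (1 : Matrix (Fin d) (Fin d) ℝ)]
      congr 1
      push_cast
      field_simp
    rw [h]
    exact S.smul_mem _ (S.sum_mem fun x _ => hTS x)
  have hP : ∀ x, vecMulVec (v x) (v x) ∈ S := fun x => by
    have h : vecMulVec (v x) (v x) = (1 / 2 : ℝ) • (T x + 1) := by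
      rw [hT, sub_add_cancel, smul_smul]
      norm_num
    rw [h]
    exact S.smul_mem _ (S.add_mem (hTS x) hone)
  have hT2_eq : ∀ j k, T2 j k = (d / (d + 1) : ℝ) • (vecMulVec (v j) (v j) + vecMulVec (v k) (v k)
      - (vecMulVec (v j) (v k) + vecMulVec (v k) (v j))) - 1 := fun j k => by
    have hc : Real.sqrt (d / (2 * (d + 1))) * Real.sqrt (d / (2 * (d + 1))) =
        d / (2 * (d + 1)) := Real.mul_self_sqrt (by positivity)
    rw [hT2, hw, smul_vecMulVec, vecMulVec_smul, smul_smul, smul_smul, mul_assoc, hc]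
    congr 1
    have h2 : (2 : ℝ) * (d / (2 * (d + 1))) = d / (d + 1) := by field_simp
    rw [h2]
    congr 1
    ext a b
    simp [vecMulVec_apply]
    ring
  have hQ_lt : ∀ k l, 0 < k → k < l → vecMulVec (v k) (v l) + vecMulVec (v l) (v k) ∈ S := by
    intro k l hk hkl
    have h : vecMulVec (v k) (v l) + vecMulVec (v l) (v k) =
        vecMulVec (v k) (v k) + vecMulVec (v l) (v l) - ((d + 1) / d : ℝ) • (T2 k l + 1) := by
      rw [hT2_eq, sub_add_cancel, smul_smul, div_mul_div_cancel₀ hd0, div_self hd1, one_smul,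
        sub_sub_cancel]
    rw [h]
    exact S.sub_mem (S.add_mem (hP k) (hP l)) (S.smul_mem _
      (S.add_mem (Submodule.subset_span (Or.inr ⟨k, l, hk, hkl, rfl⟩)) hone))
  have hQ : ∀ k l, 0 < k → 0 < l → vecMulVec (v k) (v l) + vecMulVec (v l) (v k) ∈ S := by
    intro k l hk hl
    rcases lt_trichotomy k l with h | rfl | h
    · exact hQ_lt k l hk h
    · exact S.add_mem (hP k) (hP k)
    · rw [add_comm]
      exact hQ_lt l k hl h
  intro j hj
  have hv0 : v 0 = -∑ i : Fin d, v i.succ := by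
    rw [Fin.sum_univ_succ] at hsum
    exact eq_neg_of_add_eq_zero_left hsum
  have hQ0 : vecMulVec (v 0) (v j) + vecMulVec (v j) (v 0) ∈ S := by
    have h : vecMulVec (v 0) (v j) + vecMulVec (v j) (v 0) =
        -∑ i : Fin d, (vecMulVec (v i.succ) (v j) + vecMulVec (v j) (v i.succ)) := by
      rw [hv0]
      ext a b
      simp [vecMulVec_apply, Matrix.sum_apply, Finset.sum_add_distrib, Finset.sum_mul, Finset.mul_sum]
      ring
    rw [h]
    exact S.neg_mem (S.sum_mem fun i _ => hQ _ _ i.succ_pos (Fin.pos_iff_ne_zero.mpr hj))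
  rw [hT2_eq]
  exact S.sub_mem (S.smul_mem _ (S.sub_mem (S.add_mem (hP 0) (hP j)) hQ0)) hone
end
end

section
/- Let d > 2 and let v_0,…,v_d ∈ ℝ^d be unit vectors with v_jᵀ v_k = −1/d for all j ≠ k. Define T_x := 2 v_x v_xᵀ − I and T_{jk} := 2 w_{jk} w_{jk}ᵀ − I with w_{jk} := √(d/(2(d+1))) (v_j − v_k). Let T = {T_x : 0 ≤ x ≤ d} ∪ {T_{jk} : 0 ≤ j < k ≤ d}, let T' = T \ {T_{0j} : 1 ≤ j ≤ d}, and let T'' = T' \ {T_{12}}. Then T'' is a maximal linearly independent subset of T: T'' is linearly independent over ℝ, has cardinality d(d+1)/2, and span_ℝ(T'') = span_ℝ(T) = H_d(ℝ). -/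
open scoped BigOperators Matrix

noncomputable section

open SelfTest Matrix

/-- The vertices of a regular simplex centred at the origin sum to zero. -/
lemma simplex_sum_eq_zero {d : ℕ} (hd : 0 < d) (v : Fin (d + 1) → Fin d → ℝ)
    (hunit : ∀ j, v j ⬝ᵥ v j = 1) (hangle : ∀ j k, j ≠ k → v j ⬝ᵥ v k = -(1 / d)) :
    ∑ j, v j = 0 := by
  have hd' : (d : ℝ) ≠ 0 := by positivity
  have key : ∀ k, (∑ j, v j) ⬝ᵥ v k = 0 := by
    intro k
    rw [sum_dotProduct, ← Finset.add_sum_erase _ _ (Finset.mem_univ k), hunit,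
      Finset.sum_congr rfl (fun j hj => hangle j k (Finset.ne_of_mem_erase hj))]
    simp [Finset.card_erase_of_mem, hd']
  rw [← dotProduct_self_eq_zero, dotProduct_sum]
  exact Finset.sum_eq_zero fun k _ => key k

/-- The vertices of a regular simplex form a tight frame. -/
lemma simplex_sum_vecMulVec {d : ℕ} (hd : 0 < d) (v : Fin (d + 1) → Fin d → ℝ)
    (hunit : ∀ j, v j ⬝ᵥ v j = 1) (hangle : ∀ j k, j ≠ k → v j ⬝ᵥ v k = -(1 / d)) :
    ∑ j, vecMulVec (v j) (v j) = (((d : ℝ) + 1) / d) • (1 : Matrix (Fin d) (Fin d) ℝ) := by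
  have hd' : (d : ℝ) ≠ 0 := by positivity
  have hsum := simplex_sum_eq_zero hd v hunit hangle
  set c : ℝ := ((d : ℝ) + 1) / d with hc
  set F := ∑ j, vecMulVec (v j) (v j) with hF
  have hFsymm : Fᵀ = F := by
    simp [hF, transpose_sum, transpose_vecMulVec]
  have hFv : ∀ k, F *ᵥ v k = c • v k := by
    intro k
    have h1 : ∀ j, vecMulVec (v j) (v j) *ᵥ v k
        = (-(1 / d) : ℝ) • v j + if j = k then c • v k else 0 := by
      intro j
      rw [vecMulVec_mulVec]
      by_cases h : j = k
      · subst h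
        ext i
        simp [hunit, hc]
        field_simp
        ring
      · ext i
        simp [hangle j k h, h, mul_comm]
    rw [hF, sum_mulVec, Finset.sum_congr rfl fun j _ => h1 j, Finset.sum_add_distrib,
      ← Finset.smul_sum, hsum]
    simp
  have hFF : F * F = c • F := by
    conv_lhs => rhs; rw [hF]
    rw [Finset.mul_sum, hF, Finset.smul_sum, ← hF]
    exact Finset.sum_congr rfl fun k _ => by rw [mul_vecMulVec, hFv, smul_vecMulVec]
  have htr : F.trace = d + 1 := by
    simp [hF, trace_sum, trace_vecMulVec, hunit]
  have hM : F - c • 1 = 0 := by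
    rw [← trace_conjTranspose_mul_self_eq_zero_iff, conjTranspose_eq_transpose_of_trivial]
    simp only [transpose_sub, hFsymm, transpose_smul, transpose_one, sub_mul, mul_sub, hFF,
      trace_sub, trace_smul, htr, smul_mul_assoc, mul_smul_comm, mul_one, one_mul, trace_one,
      Fintype.card_fin, smul_eq_mul, hc]
    field_simp
    ring
  exact sub_eq_zero.mp hM

/-- A submodule containing all the vertex reflections and all the edge reflections `T2 j k` with
`j, k ≠ 0`, apart from a single edge `{a, b}`, contains every symmetric matrix. -/
lemma isSymm_mem_of_simplex_reflections {d : ℕ} (hd : 2 < d) (v : Fin (d + 1) → Fin d → ℝ)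
    (hunit : ∀ j, v j ⬝ᵥ v j = 1) (hangle : ∀ j k, j ≠ k → v j ⬝ᵥ v k = -(1 / d))
    (S : Submodule ℝ (Matrix (Fin d) (Fin d) ℝ)) (a b : Fin (d + 1))
    (ha : a ≠ 0) (hb : b ≠ 0) (hab : a ≠ b)
    (hvert : ∀ x, (2 : ℝ) • vecMulVec (v x) (v x) - 1 ∈ S)
    (hedge : ∀ j k, j ≠ 0 → k ≠ 0 → j ≠ k → s(j, k) ≠ s(a, b) →
      ((d : ℝ) / (d + 1)) • vecMulVec (v j - v k) (v j - v k) - 1 ∈ S)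
    (H : Matrix (Fin d) (Fin d) ℝ) (hH : H.IsSymm) : H ∈ S := by
  have hd0 : (d : ℝ) ≠ 0 := by positivity
  have hd1 : (d : ℝ) + 1 ≠ 0 := by positivity
  have hd2 : (2 : ℝ) - d ≠ 0 := by
    have : (2 : ℝ) < d := by exact_mod_cast hd
    linarith
  have hsum := simplex_sum_eq_zero (by omega) v hunit hangle
  have hframe := simplex_sum_vecMulVec (by omega) v hunit hangle
  have hone : (1 : Matrix (Fin d) (Fin d) ℝ) ∈ S := by
    have h := S.sum_mem (t := Finset.univ) fun x _ => hvert x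
    rw [Finset.sum_sub_distrib, ← Finset.smul_sum, hframe] at h
    have h2 : (2 : ℝ) • (((d : ℝ) + 1) / d) • (1 : Matrix (Fin d) (Fin d) ℝ)
        - ∑ _x : Fin (d + 1), (1 : Matrix (Fin d) (Fin d) ℝ)
        = (((d : ℝ) + 1) * (2 - d) / d) • 1 := by
      rw [Finset.sum_const, Finset.card_univ, Fintype.card_fin, ← Nat.cast_smul_eq_nsmul ℝ,
        smul_smul, ← sub_smul]
      congr 1
      push_cast
      field_simp
    rw [h2] at h
    exact (S.smul_mem_iff (div_ne_zero (mul_ne_zero hd1 hd2) hd0)).mp h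
  have hP : ∀ x, vecMulVec (v x) (v x) ∈ S := fun x => by
    have h := S.add_mem (hvert x) hone
    rw [sub_add_cancel] at h
    exact (S.smul_mem_iff two_ne_zero).mp h
  let Q : Fin (d + 1) → Fin (d + 1) → Matrix (Fin d) (Fin d) ℝ := fun j k =>
    vecMulVec (v j) (v k) + vecMulVec (v k) (v j)
  have hQcomm : ∀ j k, Q j k = Q k j := fun j k => add_comm _ _
  have hQself : ∀ j, Q j j ∈ S := fun j => S.add_mem (hP j) (hP j)
  have hQsum : ∀ j, ∑ k, Q j k = 0 := by
    intro j
    ext x y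
    have hx : ∀ x, ∑ k, v k x = 0 := fun x => by
      simpa using congrFun hsum x
    simp only [Q, Matrix.sum_apply, Matrix.add_apply, vecMulVec_apply, Finset.sum_add_distrib,
      ← Finset.mul_sum, ← Finset.sum_mul, hx]
    simp
  have hQedge : ∀ j k, j ≠ 0 → k ≠ 0 → s(j, k) ≠ s(a, b) → Q j k ∈ S := by
    intro j k hj hk hjk
    by_cases h : j = k
    · exact h ▸ hQself j
    have h1 := S.add_mem (hedge j k hj hk h hjk) hone
    rw [sub_add_cancel, S.smul_mem_iff (by positivity)] at h1
    have h2 := S.sub_mem (S.add_mem (hP j) (hP k)) h1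
    convert h2 using 1
    simp only [Q, vecMulVec_sub, sub_vecMulVec]
    abel
  have hQpair : ∀ j k l, k ≠ l → (∀ m, m ≠ k → m ≠ l → Q j m ∈ S) → Q j k + Q j l ∈ S := by
    intro j k l hkl h
    have h0 := hQsum j
    rw [← Finset.add_sum_erase _ _ (Finset.mem_univ k),
      ← Finset.add_sum_erase _ _ (Finset.mem_erase.mpr ⟨hkl.symm, Finset.mem_univ l⟩),
      ← add_assoc] at h0
    rw [eq_neg_of_add_eq_zero_left h0]
    refine S.neg_mem (S.sum_mem fun m hm => h m ?_ ?_)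
    · exact Finset.ne_of_mem_erase (Finset.mem_of_mem_erase hm)
    · exact Finset.ne_of_mem_erase hm
  have hQ0 : ∀ j, j ≠ a → j ≠ b → j ≠ 0 → Q j 0 ∈ S := by
    intro j hja hjb hj0
    have h := hQpair j 0 j hj0.symm fun m hm0 _ => hQedge j m hj0 hm0 (by
      simp [hja, hjb])
    exact (S.add_mem_iff_left (hQself j)).mp h
  have ea : Q a 0 + Q a b ∈ S := hQpair a 0 b hb.symm fun m hm0 hmb =>
    hQedge a m ha hm0 (by simp [hmb, hab])
  have eb : Q b 0 + Q b a ∈ S := hQpair b 0 a ha.symm fun m hm0 hma =>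
    hQedge b m hb hm0 (by simp [hma, hab.symm])
  have e0 : Q 0 a + Q 0 b ∈ S := hQpair 0 a b hab fun m hma hmb => by
    by_cases hm : m = 0
    · exact hm ▸ hQself 0
    · exact hQcomm m 0 ▸ hQ0 m hma hmb hm
  have hQab : Q a b ∈ S := by
    have h := S.sub_mem (S.add_mem ea eb) e0
    rw [hQcomm b a, hQcomm 0 a, hQcomm 0 b] at h
    have h2 : Q a 0 + Q a b + (Q b 0 + Q a b) - (Q a 0 + Q b 0) = (2 : ℝ) • Q a b := by
      rw [two_smul]; abel
    rw [h2] at h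
    exact (S.smul_mem_iff two_ne_zero).mp h
  have hQ0' : ∀ j, Q j 0 ∈ S := by
    intro j
    by_cases hj0 : j = 0
    · exact hj0 ▸ hQself 0
    by_cases hja : j = a
    · exact hja ▸ (S.add_mem_iff_left hQab).mp ea
    by_cases hjb : j = b
    · exact hjb ▸ (S.add_mem_iff_left (hQcomm a b ▸ hQab)).mp eb
    exact hQ0 j hja hjb hj0
  have hQ : ∀ j k, Q j k ∈ S := by
    intro j k
    by_cases hj : j = 0
    · rw [hj, hQcomm]
      exact hQ0' k
    by_cases hk : k = 0
    · exact hk ▸ hQ0' j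
    by_cases hs : s(j, k) = s(a, b)
    · rcases Sym2.eq_iff.mp hs with ⟨rfl, rfl⟩ | ⟨rfl, rfl⟩
      · exact hQab
      · exact hQcomm k j ▸ hQab
    · exact hQedge j k hj hk hs
  set c : ℝ := ((d : ℝ) + 1) / d with hc
  have hc0 : c ≠ 0 := by positivity
  have hexp : (c * c) • H = ∑ j, ∑ k, (v j ⬝ᵥ H *ᵥ v k) • vecMulVec (v j) (v k) := by
    calc (c * c) • H = (c • 1) * H * (c • 1) := by simp [smul_smul]
      _ = _ := by
        rw [← hframe, Finset.sum_mul, Finset.sum_mul]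
        refine Finset.sum_congr rfl fun j _ => ?_
        rw [Finset.mul_sum]
        refine Finset.sum_congr rfl fun k _ => ?_
        rw [mul_assoc, mul_vecMulVec, vecMulVec_mul_vecMulVec, vecMulVec_smul]
  have hsymm : ∀ j k, v j ⬝ᵥ H *ᵥ v k = v k ⬝ᵥ H *ᵥ v j := by
    intro j k
    rw [dotProduct_mulVec, ← mulVec_transpose, hH.eq, dotProduct_comm]
  have hexp2 : (2 * (c * c)) • H = ∑ j, ∑ k, (v j ⬝ᵥ H *ᵥ v k) • Q j k := by
    rw [mul_smul, two_smul]
    nth_rewrite 2 [hexp]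
    rw [Finset.sum_comm, hexp, ← Finset.sum_add_distrib]
    refine Finset.sum_congr rfl fun j _ => ?_
    rw [← Finset.sum_add_distrib]
    refine Finset.sum_congr rfl fun k _ => ?_
    rw [hsymm k j, ← smul_add]
  have h2c : 2 * (c * c) ≠ 0 := by positivity
  rw [← S.smul_mem_iff h2c, hexp2]
  exact S.sum_mem fun j _ => S.sum_mem fun k _ => S.smul_mem _ (hQ j k)

/-- A submodule containing all symmetric matrices has dimension at least `d (d + 1) / 2`. -/
lemma card_sym2_le_finrank {d : ℕ} (S : Submodule ℝ (Matrix (Fin d) (Fin d) ℝ))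
    (hS : ∀ H : Matrix (Fin d) (Fin d) ℝ, H.IsSymm → H ∈ S) :
    Fintype.card (Sym2 (Fin d)) ≤ Module.finrank ℝ S := by
  let φ : (Sym2 (Fin d) → ℝ) →ₗ[ℝ] S :=
    { toFun := fun f => ⟨Matrix.of fun i j => f s(i, j), hS _ (by
        ext i j
        simp [Sym2.eq_swap])⟩
      map_add' := fun f g => rfl
      map_smul' := fun r f => rfl }
  have hφ : Function.Injective φ := by
    intro f g h
    ext s
    induction s using Sym2.ind with
    | _ i j => exact congrFun (congrFun (congrArg Subtype.val h) i) j
  simpa using LinearMap.finrank_le_finrank_of_injective hφ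

/-- Unit vectors defining the same reflection have inner product `±1`. -/
lemma dotProduct_mul_self_eq_one_of_vecMulVec_eq {d : ℕ} {x y : Fin d → ℝ} (hx : x ⬝ᵥ x = 1)
    (h : (2 : ℝ) • vecMulVec x x - 1 = (2 : ℝ) • vecMulVec y y - 1) :
    (x ⬝ᵥ y) * (x ⬝ᵥ y) = 1 := by
  have h1 : vecMulVec x x = vecMulVec y y :=
    smul_right_injective _ (two_ne_zero (α := ℝ)) (sub_left_injective h)
  have h2 := congrArg (fun M => x ⬝ᵥ M *ᵥ x) h1
  simp only [vecMulVec_mulVec, hx] at h2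
  simp [hx, dotProduct_comm y x] at h2
  exact h2.symm

/-- `T'' = T \ ({T_{0j}} ∪ {T_{12}})` is a maximal linearly independent
subset of `T`, of cardinality `d(d+1)/2`, spanning the symmetric matrices. -/
theorem stmt_10 {d : ℕ} (hd : 2 < d)
    (v : Fin (d + 1) → Fin d → ℝ)
    (hunit : ∀ j, v j ⬝ᵥ v j = 1)
    (hangle : ∀ j k, j ≠ k → v j ⬝ᵥ v k = -(1 / d))
    (T : Fin (d + 1) → Matrix (Fin d) (Fin d) ℝ)
    (hT : ∀ x, T x = (2 : ℝ) • Matrix.vecMulVec (v x) (v x) - 1)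
    (w : Fin (d + 1) → Fin (d + 1) → Fin d → ℝ)
    (hw : ∀ j k, w j k = Real.sqrt (d / (2 * (d + 1))) • (v j - v k))
    (T2 : Fin (d + 1) → Fin (d + 1) → Matrix (Fin d) (Fin d) ℝ)
    (hT2 : ∀ j k, T2 j k = (2 : ℝ) • Matrix.vecMulVec (w j k) (w j k) - 1)
    (Tset T'set T''set : Set (Matrix (Fin d) (Fin d) ℝ))
    (hTset : Tset = Set.range T ∪ {M | ∃ j k : Fin (d + 1), j < k ∧ M = T2 j k})
    (hT'set : T'set = Tset \ {M | ∃ j : Fin (d + 1), j ≠ 0 ∧ M = T2 0 j})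
    (hT''set : T''set = T'set \ {T2 1 2}) :
    LinearIndependent ℝ (fun x : T''set => (x : Matrix (Fin d) (Fin d) ℝ)) ∧
    T''set.ncard = d * (d + 1) / 2 ∧
    Submodule.span ℝ T''set = Submodule.span ℝ Tset ∧
    ∀ H : Matrix (Fin d) (Fin d) ℝ, H.IsSymm → H ∈ Submodule.span ℝ T''set := by
  have hd0 : (d : ℝ) ≠ 0 := by positivity
  have hd1 : (d : ℝ) + 1 ≠ 0 := by positivity
  have hdR : (2 : ℝ) < d := by exact_mod_cast hd
  have hsq : Real.sqrt (d / (2 * (d + 1))) * Real.sqrt (d / (2 * (d + 1))) = d / (2 * (d + 1)) :=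
    Real.mul_self_sqrt (by positivity)
  have hG : ∀ j k, v j ⬝ᵥ v k = (1 + 1 / d) * (if j = k then 1 else 0) - 1 / d := by
    intro j k
    by_cases h : j = k
    · simp [h, hunit]
    · simp [h, hangle j k h]
  have hww : ∀ j k l m, w j k ⬝ᵥ w l m = 1 / 2 * ((if j = l then 1 else 0)
      - (if j = m then 1 else 0) - (if k = l then 1 else 0) + (if k = m then 1 else 0)) := by
    intro j k l m
    rw [hw, hw, smul_dotProduct, dotProduct_smul, smul_eq_mul, smul_eq_mul, ← mul_assoc, hsq]
    simp only [sub_dotProduct, dotProduct_sub, hG]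
    field_simp
    ring
  have hvw : ∀ x j k, (v x ⬝ᵥ w j k) * (v x ⬝ᵥ w j k) = (d + 1) / (2 * d)
      * ((if x = j then 1 else 0) - (if x = k then 1 else 0)) ^ 2 := by
    intro x j k
    rw [hw, dotProduct_smul, smul_eq_mul, mul_mul_mul_comm, hsq]
    simp only [dotProduct_sub, hG]
    field_simp
    ring
  have hT2' : ∀ j k, T2 j k
      = ((d : ℝ) / (d + 1)) • vecMulVec (v j - v k) (v j - v k) - 1 := by
    intro j k
    rw [hT2, hw, smul_vecMulVec, vecMulVec_smul, smul_smul, smul_smul, mul_assoc, hsq]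
    congr 2
    field_simp
  have hT2comm : ∀ j k, T2 j k = T2 k j := by
    intro j k
    rw [hT2', hT2', ← neg_sub (v k) (v j), neg_vecMulVec, vecMulVec_neg, neg_neg]
  have hTne : ∀ x j k, T x ≠ T2 j k := by
    intro x j k h
    rw [hT, hT2] at h
    have h1 := dotProduct_mul_self_eq_one_of_vecMulVec_eq (hunit x) h
    rw [hvw] at h1
    have h2 : ((if x = j then (1 : ℝ) else 0) - (if x = k then 1 else 0)) ^ 2 ≤ 1 := by
      split_ifs <;> norm_num
    have h3 : ((d : ℝ) + 1) / (2 * d) < 1 := by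
      rw [div_lt_one (by positivity)]
      linarith
    have h4 : 0 < ((d : ℝ) + 1) / (2 * d) := by positivity
    nlinarith
  have hT2ne : ∀ j k l m, j ≠ k → l ≠ m → T2 j k = T2 l m → s(j, k) = s(l, m) := by
    intro j k l m hjk hlm h
    rw [hT2, hT2] at h
    have hunit' : w j k ⬝ᵥ w j k = 1 := by
      rw [hww]
      simp [hjk, hjk.symm]
      norm_num
    have h1 := dotProduct_mul_self_eq_one_of_vecMulVec_eq hunit' h
    rw [hww] at h1
    rw [Sym2.eq_iff]
    by_contra hcon
    split_ifs at h1 <;> first | (norm_num at h1; done) | (subst_vars; simp_all)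
  have hf0 : (⟨0, by omega⟩ : Fin d).succ = 1 := by
    ext
    simp [Nat.mod_eq_of_lt (show 1 < d + 1 by omega)]
  have hf1 : (⟨1, by omega⟩ : Fin d).succ = 2 := by
    ext
    simp [Nat.mod_eq_of_lt (show 2 < d + 1 by omega)]
  have h10 : (1 : Fin (d + 1)) ≠ 0 := hf0 ▸ Fin.succ_ne_zero _
  have h20 : (2 : Fin (d + 1)) ≠ 0 := hf1 ▸ Fin.succ_ne_zero _
  have h12 : (1 : Fin (d + 1)) ≠ 2 := by
    rw [← hf0, ← hf1]
    simp
  have hmemT : ∀ x, T x ∈ T''set := by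
    intro x
    rw [hT''set, hT'set, hTset]
    exact ⟨⟨Or.inl ⟨x, rfl⟩, fun ⟨j, _, h⟩ => hTne _ _ _ h⟩, fun h => hTne _ _ _ h⟩
  have hmemT2 : ∀ j k, j ≠ 0 → k ≠ 0 → j ≠ k → s(j, k) ≠ s(1, 2) → T2 j k ∈ T''set := by
    intro j k hj hk hjk hs
    rw [hT''set, hT'set, hTset]
    refine ⟨⟨Or.inr ?_, fun ⟨l, hl, h⟩ => ?_⟩, fun h => hs (hT2ne _ _ _ _ hjk h12 h)⟩
    · rcases lt_or_gt_of_ne hjk with h | h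
      · exact ⟨j, k, h, rfl⟩
      · exact ⟨k, j, h, hT2comm j k⟩
    · rcases Sym2.eq_iff.mp (hT2ne _ _ _ _ hjk hl.symm h) with h | h
      · exact hj h.1
      · exact hk h.2
  have hspan : ∀ H : Matrix (Fin d) (Fin d) ℝ, H.IsSymm → H ∈ Submodule.span ℝ T''set := by
    refine isSymm_mem_of_simplex_reflections hd v hunit hangle _ 1 2 h10 h20 h12 (fun x => ?_)
      fun j k hj hk hjk hs => ?_
    · rw [← hT]
      exact Submodule.subset_span (hmemT x)
    · rw [← hT2']
      exact Submodule.subset_span (hmemT2 j k hj hk hjk hs)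
  let g : Sym2 (Fin d) → Matrix (Fin d) (Fin d) ℝ := fun s =>
    if s = s(⟨0, by omega⟩, ⟨1, by omega⟩) then T 0 else
      Sym2.lift ⟨fun i j => if i = j then T i.succ else T2 i.succ j.succ, fun i j => by
        by_cases h : i = j
        · simp [h]
        · simp [h, Ne.symm h, hT2comm i.succ j.succ]⟩ s
  have hsub : T''set ⊆ Set.range g := by
    intro M hM
    rw [hT''set, hT'set, hTset] at hM
    obtain ⟨⟨⟨x, rfl⟩ | ⟨j, k, hjk, rfl⟩, hM0⟩, hM12⟩ := hM
    · induction x using Fin.cases with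
      | zero => exact ⟨s(⟨0, by omega⟩, ⟨1, by omega⟩), by simp [g]⟩
      | succ i =>
        refine ⟨s(i, i), ?_⟩
        have : s(i, i) ≠ s((⟨0, by omega⟩ : Fin d), ⟨1, by omega⟩) := by
          simp only [ne_eq, Sym2.eq_iff, Fin.ext_iff]
          omega
        simp [g, this]
    · induction k using Fin.cases with
      | zero => exact absurd hjk (Fin.not_lt_zero j)
      | succ k =>
      induction j using Fin.cases with
      | zero => exact absurd ⟨k.succ, Fin.succ_ne_zero k, rfl⟩ hM0
      | succ j =>
        have hjk' : j < k := Fin.succ_lt_succ_iff.mp hjk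
        refine ⟨s(j, k), ?_⟩
        have : s(j, k) ≠ s((⟨0, by omega⟩ : Fin d), ⟨1, by omega⟩) := by
          intro h
          rcases Sym2.eq_iff.mp h with ⟨hj, hk⟩ | ⟨hj, hk⟩
          · exact hM12 (by rw [hj, hk, hf0, hf1]; rfl)
          · exact absurd hjk' (by simp [hj, hk])
        simp [g, this, hjk'.ne]
  have hfin : T''set.Finite := (Set.finite_range g).subset hsub
  have hle : T''set.ncard ≤ Fintype.card (Sym2 (Fin d)) := by
    calc T''set.ncard ≤ (Set.range g).ncard := Set.ncard_le_ncard hsub (Set.finite_range g)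
      _ ≤ Nat.card (Sym2 (Fin d)) := by
        rw [← Set.image_univ, ← Set.ncard_univ]
        exact Set.ncard_image_le
      _ = _ := Nat.card_eq_fintype_card
  have hge := card_sym2_le_finrank _ hspan
  have : Fintype T''set := hfin.fintype
  have hcard : Fintype.card T''set = T''set.ncard := by
    rw [← Nat.card_eq_fintype_card, Nat.card_coe_set_eq]
  have hrank : Module.finrank ℝ (Submodule.span ℝ T''set) ≤ T''set.ncard := by
    rw [← hcard, ← Set.toFinset_card]
    exact finrank_span_le_card T''set
  refine ⟨?_, ?_, ?_, hspan⟩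
  · rw [linearIndependent_iff_card_le_finrank_span, Subtype.range_coe, Set.finrank, hcard]
    exact hle.trans hge
  · rw [le_antisymm hle (hge.trans hrank), Sym2.card, Fintype.card_fin, Nat.choose_two_right,
      Nat.add_sub_cancel, mul_comm]
  · refine le_antisymm (Submodule.span_mono ?_) (Submodule.span_le.mpr ?_)
    · rw [hT''set, hT'set]
      exact Set.sdiff_subset.trans Set.sdiff_subset
    · rw [hTset]
      rintro _ (⟨x, rfl⟩ | ⟨j, k, -, rfl⟩)
      · refine hspan _ ?_
        simp [Matrix.IsSymm, hT, transpose_vecMulVec]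
      · refine hspan _ ?_
        simp [Matrix.IsSymm, hT2, transpose_vecMulVec]
end
end

section
/- Let {Ã_x} be a finite set of d×d real symmetric orthogonal matrices. Define recursively V_0 := span_ℝ({I} ∪ {Ã_x : x}) and V_j := span_ℝ(sgn(V_{j−1})) for j ≥ 1, so that V_0 ⊆ V_1 ⊆ V_2 ⊆ ⋯ is an increasing chain of subspaces of H_d(ℝ). Then the union V_∞ := ⋃_{j≥0} V_j (at which the chain stabilizes) equals JA({Ã_x}), the real Jordan algebra generated by {Ã_x}. -/
open scoped BigOperators Matrix

noncomputable section

namespace SelfTest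

/-- The iterated subspaces `V_0 = span S`, `V_{j+1} = span (sgn(V_j))`. -/
def Vseq {d : ℕ} (S : Set (Matrix (Fin d) (Fin d) ℝ)) :
    ℕ → Submodule ℝ (Matrix (Fin d) (Fin d) ℝ)
  | 0 => Submodule.span ℝ S
  | j + 1 => Submodule.span ℝ (msgn '' (Vseq S j : Set (Matrix (Fin d) (Fin d) ℝ)))

/-- The real Jordan algebra generated by a set `S` of symmetric matrices: the smallest
linear subspace containing `S ∪ {I}` and closed under the Jordan product
`a ∘ b = (ab + ba)/2`. -/
def JAgen {d : ℕ} (S : Set (Matrix (Fin d) (Fin d) ℝ)) :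
    Submodule ℝ (Matrix (Fin d) (Fin d) ℝ) :=
  sInf {W | S ⊆ (W : Set (Matrix (Fin d) (Fin d) ℝ)) ∧
    (1 : Matrix (Fin d) (Fin d) ℝ) ∈ W ∧
    ∀ a ∈ W, ∀ b ∈ W, (1 / 2 : ℝ) • (a * b + b * a) ∈ W}

/-- The iterated Jordan-product spans: `W_0 = span S`,
`W_{j+1} = span {a ∘ b : a, b ∈ W_j}`. -/
def Wseq {d : ℕ} (S : Set (Matrix (Fin d) (Fin d) ℝ)) :
    ℕ → Submodule ℝ (Matrix (Fin d) (Fin d) ℝ)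
  | 0 => Submodule.span ℝ S
  | j + 1 => Submodule.span ℝ
      {m | ∃ a ∈ Wseq S j, ∃ b ∈ Wseq S j, m = (1 / 2 : ℝ) • (a * b + b * a)}

end SelfTest

open SelfTest

namespace SelfTest

lemma continuousOn_spectrum {d : ℕ} (H : Matrix (Fin d) (Fin d) ℝ) (f : ℝ → ℝ) :
    ContinuousOn f (spectrum ℝ H) :=
  H.finite_spectrum.continuousOn f

/-- The matrix sign is the functional calculus of the real sign function. -/
lemma msgn_eq_cfc {d : ℕ} {H : Matrix (Fin d) (Fin d) ℝ} (h : IsSelfAdjoint H) :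
    msgn H = cfc Real.sign H := by
  have h' : H.IsHermitian := h
  rw [h'.cfc_eq, msgn, dif_pos h', Matrix.IsHermitian.cfc, Unitary.conjStarAlgAut_apply]
  rfl

lemma isSelfAdjoint_msgn {d : ℕ} (H : Matrix (Fin d) (Fin d) ℝ) : IsSelfAdjoint (msgn H) := by
  by_cases h : IsSelfAdjoint H
  · rw [msgn_eq_cfc h]
    exact cfc_predicate Real.sign H
  · rw [msgn, dif_neg (by exact h)]
    exact IsSelfAdjoint.zero _

lemma msgn_of_mul_self_eq_one {d : ℕ} {M : Matrix (Fin d) (Fin d) ℝ} (h : IsSelfAdjoint M)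
    (hM : M * M = 1) : msgn M = M := by
  have hsq : cfc (fun x : ℝ => x ^ 2) M = cfc (fun _ : ℝ => (1 : ℝ)) M := by
    rw [cfc_pow_id M 2, cfc_const_one ℝ M, pow_two, hM]
  have heq : (spectrum ℝ M).EqOn (fun x : ℝ => x ^ 2) (fun _ => 1) :=
    (cfc_eq_cfc_iff_eqOn h (continuousOn_spectrum M _) (continuousOn_spectrum M _)).1 hsq
  rw [msgn_eq_cfc h]
  conv_rhs => rw [← cfc_id ℝ M]
  refine cfc_congr fun x hx => ?_
  rcases mul_self_eq_one_iff.1 ((pow_two x).symm.trans (heq hx)) with rfl | rfl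
  · simp
  · simp [Real.sign_of_neg]

lemma msgn_sub_algebraMap {d : ℕ} {H : Matrix (Fin d) (Fin d) ℝ} (h : IsSelfAdjoint H) (t : ℝ) :
    msgn (H - algebraMap ℝ _ t) = cfc (fun x => Real.sign (x - t)) H := by
  have hs : cfc (fun x : ℝ => x - t) H = H - algebraMap ℝ _ t := by
    rw [cfc_sub (fun x : ℝ => x) (fun _ => t) H, cfc_id' ℝ H, cfc_const t H]
  have hsa : IsSelfAdjoint (H - algebraMap ℝ _ t) := hs ▸ cfc_predicate _ H
  rw [msgn_eq_cfc hsa, ← hs]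
  exact (cfc_comp' Real.sign (fun x : ℝ => x - t) H
    ((H.finite_spectrum.image _).continuousOn _) (continuousOn_spectrum H _) h).symm

/-- Around a point of a finite set, the indicator of the point is half a difference of two
shifted sign functions. -/
lemma exists_single_eqOn_sign {s : Set ℝ} (hs : s.Finite) (a : ℝ) :
    ∃ u v : ℝ, s.EqOn (Pi.single a 1)
      (fun x => (1 / 2 : ℝ) * (Real.sign (x - u) - Real.sign (x - v))) := by
  have hopen : IsOpen (s \ {a})ᶜ := (hs.sdiff).isClosed.isOpen_compl
  obtain ⟨ε, hε, hball⟩ := Metric.isOpen_iff.1 hopen a (by simp)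
  refine ⟨a - ε / 2, a + ε / 2, fun x hx => ?_⟩
  rcases eq_or_ne x a with rfl | hxa
  · simp only [Pi.single_eq_same]
    rw [Real.sign_of_pos (by linarith), Real.sign_of_neg (by linarith)]
    norm_num
  · have hfar : ε ≤ |x - a| := by
      by_contra! hlt
      exact hball (by simpa [Real.dist_eq] using hlt) ⟨hx, hxa⟩
    simp only [Pi.single_eq_of_ne hxa]
    rcases le_abs.1 hfar with hpos | hneg
    · rw [Real.sign_of_pos (by linarith), Real.sign_of_pos (by linarith)]
      norm_num
    · rw [Real.sign_of_neg (by linarith), Real.sign_of_neg (by linarith)]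
      norm_num

/-- A subspace containing `1` and closed under the matrix sign is closed under the functional
calculus. -/
lemma cfc_mem_of_msgn_mem {d : ℕ} {W : Submodule ℝ (Matrix (Fin d) (Fin d) ℝ)} (h1 : 1 ∈ W)
    (hsgn : ∀ H ∈ W, msgn H ∈ W) {H : Matrix (Fin d) (Fin d) ℝ} (hH : H ∈ W)
    (h : IsSelfAdjoint H) (f : ℝ → ℝ) : cfc f H ∈ W := by
  have hshift : ∀ t : ℝ, cfc (fun x => Real.sign (x - t)) H ∈ W := fun t => by
    rw [← msgn_sub_algebraMap h]
    refine hsgn _ (W.sub_mem hH ?_)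
    rw [Algebra.algebraMap_eq_smul_one]
    exact W.smul_mem _ h1
  have hsingle : ∀ a : ℝ, cfc (Pi.single a 1 : ℝ → ℝ) H ∈ W := fun a => by
    obtain ⟨u, v, huv⟩ := exists_single_eqOn_sign H.finite_spectrum a
    rw [cfc_congr huv, cfc_const_mul _ _ H (continuousOn_spectrum H _),
      cfc_sub _ _ H (continuousOn_spectrum H _) (continuousOn_spectrum H _)]
    exact W.smul_mem _ (W.sub_mem (hshift u) (hshift v))
  have hf : (spectrum ℝ H).EqOn f
      (∑ a ∈ H.finite_spectrum.toFinset, fun x => f a * (Pi.single a 1 : ℝ → ℝ) x) := by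
    intro x hx
    rw [Finset.sum_apply, Finset.sum_eq_single x]
    · simp
    · intro b _ hb
      simp [Pi.single_eq_of_ne hb.symm]
    · intro hx'
      exact absurd (H.finite_spectrum.mem_toFinset.2 hx) hx'
  rw [cfc_congr hf, cfc_sum _ _ _ fun _ _ => continuousOn_spectrum H _]
  refine W.sum_mem fun a _ => ?_
  rw [cfc_const_mul _ _ H (continuousOn_spectrum H _)]
  exact W.smul_mem _ (hsingle a)

lemma jordan_mem_of_msgn_mem {d : ℕ} {W : Submodule ℝ (Matrix (Fin d) (Fin d) ℝ)} (h1 : 1 ∈ W)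
    (hsgn : ∀ H ∈ W, msgn H ∈ W) (hsa : ∀ H ∈ W, IsSelfAdjoint H)
    {a b : Matrix (Fin d) (Fin d) ℝ} (ha : a ∈ W) (hb : b ∈ W) :
    (1 / 2 : ℝ) • (a * b + b * a) ∈ W := by
  have hsq : ∀ H ∈ W, H * H ∈ W := fun H hH => by
    have := hsa H hH
    rw [← pow_two, ← cfc_pow_id (R := ℝ) H 2]
    exact cfc_mem_of_msgn_mem h1 hsgn hH this _
  have hab : a * b + b * a = (a + b) * (a + b) - a * a - b * b := by noncomm_ring
  rw [hab]
  exact W.smul_mem _ (W.sub_mem (W.sub_mem (hsq _ (W.add_mem ha hb)) (hsq a ha)) (hsq b hb))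

lemma msgn_mem_of_jordan_mem {d : ℕ} {W : Submodule ℝ (Matrix (Fin d) (Fin d) ℝ)} (h1 : 1 ∈ W)
    (hW : ∀ a ∈ W, ∀ b ∈ W, (1 / 2 : ℝ) • (a * b + b * a) ∈ W)
    {H : Matrix (Fin d) (Fin d) ℝ} (hH : H ∈ W) : msgn H ∈ W := by
  by_cases h : IsSelfAdjoint H
  · have hpow : ∀ n : ℕ, H ^ n ∈ W := fun n => by
      induction n with
      | zero => simpa using h1
      | succ n ih =>
        have hn := hW _ ih _ hH
        rw [← pow_succ, ← pow_succ', ← two_smul ℝ, smul_smul] at hn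
        simpa using hn
    let p := Lagrange.interpolate H.finite_spectrum.toFinset id Real.sign
    have hp : (spectrum ℝ H).EqOn Real.sign p.eval := fun x hx =>
      (Lagrange.eval_interpolate_at_node Real.sign (Set.injOn_id _)
        (H.finite_spectrum.mem_toFinset.2 hx)).symm
    rw [msgn_eq_cfc h, cfc_congr hp, cfc_polynomial p H, Polynomial.aeval_eq_sum_range]
    exact W.sum_mem fun n _ => W.smul_mem _ (hpow n)
  · rw [msgn, dif_neg (by exact h)]
    exact W.zero_mem

lemma Vseq_le_of_jordan_mem {d : ℕ} {S : Set (Matrix (Fin d) (Fin d) ℝ)}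
    {W : Submodule ℝ (Matrix (Fin d) (Fin d) ℝ)} (hS : S ⊆ W) (h1 : 1 ∈ W)
    (hW : ∀ a ∈ W, ∀ b ∈ W, (1 / 2 : ℝ) • (a * b + b * a) ∈ W) (j : ℕ) : Vseq S j ≤ W := by
  induction j with
  | zero => exact Submodule.span_le.2 hS
  | succ j ih =>
    refine Submodule.span_le.2 ?_
    rintro _ ⟨H, hH, rfl⟩
    exact msgn_mem_of_jordan_mem h1 hW (ih hH)

lemma Vseq_monotone {d : ℕ} {S : Set (Matrix (Fin d) (Fin d) ℝ)} (hS : ∀ M ∈ S, msgn M = M) :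
    Monotone (Vseq S) := by
  refine monotone_nat_of_le_succ fun j => ?_
  induction j with
  | zero => exact Submodule.span_mono fun M hM => ⟨M, Submodule.subset_span hM, hS M hM⟩
  | succ j ih => exact Submodule.span_mono (Set.image_mono ih)

lemma isSelfAdjoint_of_mem_Vseq {d : ℕ} {S : Set (Matrix (Fin d) (Fin d) ℝ)}
    (hS : ∀ M ∈ S, IsSelfAdjoint M) (j : ℕ) {H : Matrix (Fin d) (Fin d) ℝ} (hH : H ∈ Vseq S j) :
    IsSelfAdjoint H := by
  suffices h : Vseq S j ≤ selfAdjoint.submodule ℝ (Matrix (Fin d) (Fin d) ℝ) from h hH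
  cases j with
  | zero => exact Submodule.span_le.2 hS
  | succ j =>
    refine Submodule.span_le.2 ?_
    rintro _ ⟨H, -, rfl⟩
    exact isSelfAdjoint_msgn H

end SelfTest

/-- the iterative sgn-span closure equals the generated Jordan algebra
(Proposition `jordan`). -/
theorem stmt_15 {d : ℕ} (A : Finset (Matrix (Fin d) (Fin d) ℝ))
    (hA : ∀ M ∈ A, M.IsSymm ∧ M * M = 1) :
    (⨆ j : ℕ, Vseq ({1} ∪ (A : Set (Matrix (Fin d) (Fin d) ℝ))) j) =
      JAgen (A : Set (Matrix (Fin d) (Fin d) ℝ)) := by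
  set S : Set (Matrix (Fin d) (Fin d) ℝ) := {1} ∪ (A : Set (Matrix (Fin d) (Fin d) ℝ)) with hS
  have hinv : ∀ M ∈ S, IsSelfAdjoint M ∧ M * M = 1 := by
    rintro M (rfl | hM)
    · exact ⟨IsSelfAdjoint.one _, mul_one _⟩
    · refine ⟨?_, (hA M hM).2⟩
      rw [IsSelfAdjoint, Matrix.star_eq_conjTranspose, Matrix.conjTranspose_eq_transpose_of_trivial]
      exact (hA M hM).1
  have hmono : Monotone (Vseq S) :=
    Vseq_monotone fun M hM => msgn_of_mul_self_eq_one (hinv M hM).1 (hinv M hM).2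
  have hmem : ∀ H, H ∈ (⨆ j, Vseq S j) ↔ ∃ j, H ∈ Vseq S j := fun H =>
    Submodule.mem_iSup_of_directed _ hmono.directed_le
  have hS_mem : ∀ M ∈ S, M ∈ ⨆ j, Vseq S j := fun M hM =>
    (hmem M).2 ⟨0, Submodule.subset_span hM⟩
  have hone : (1 : Matrix (Fin d) (Fin d) ℝ) ∈ ⨆ j, Vseq S j := hS_mem 1 (Or.inl rfl)
  apply le_antisymm
  · refine iSup_le fun j => le_sInf ?_
    rintro W ⟨hAW, h1, hW⟩
    exact Vseq_le_of_jordan_mem (Set.union_subset (by simpa using h1) hAW) h1 hW j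
  · refine sInf_le ⟨fun M hM => hS_mem M (Or.inr hM), hone, fun a ha b hb => ?_⟩
    refine jordan_mem_of_msgn_mem hone (fun H hH => ?_) (fun H hH => ?_) ha hb
    · obtain ⟨j, hj⟩ := (hmem H).1 hH
      exact (hmem _).2 ⟨j + 1, Submodule.subset_span ⟨H, hj, rfl⟩⟩
    · obtain ⟨j, hj⟩ := (hmem H).1 hH
      exact isSelfAdjoint_of_mem_Vseq (fun M hM => (hinv M hM).1) j hj
end
end
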